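/- arXiv:2108.11911 — 2 statements merged into one kernel-verified Lean document; each statement's English description precedes it below -/
import Mathlib

section
/- For all n ≥ 3 and d ≥ 2, every nonnegativity inequality X_{tq}(i,j) ≥ 0, for t,q ∈ [d] and 1 ≤ i < j ≤ n, is facet-defining for the joint matching polytope C_{n,d}: it is valid for C_{n,d}, and the face {x ∈ C_{n,d} : X_{tq}(i,j) = 0} has affine dimension (n choose 2)d² − 1. -/
/-- Index set of ordered pairs `i < j`. -/
abbrev PairIdx (n : ℕ) := {p : Fin n × Fin n // p.1 < p.2}

/-- Coordinates of the vectorization of a collection of matrices `X(i,j)`, `i < j`. -/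
abbrev JIdx (n d : ℕ) := PairIdx n × (Fin d × Fin d)

/-- `x` is the vectorization of a collection of consistent partial maps: binary entries,
row and column sums at most one, and the triangle system (gtri). -/
def IsConsistentVec (n d : ℕ) (x : JIdx n d → ℝ) : Prop :=
  (∀ (e : PairIdx n) (t q : Fin d), x (e, (t, q)) = 0 ∨ x (e, (t, q)) = 1) ∧
  (∀ (e : PairIdx n) (t : Fin d), ∑ q : Fin d, x (e, (t, q)) ≤ 1) ∧
  (∀ (e : PairIdx n) (q : Fin d), ∑ t : Fin d, x (e, (t, q)) ≤ 1) ∧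
  (∀ (i j k : Fin n) (hij : i < j) (hjk : j < k) (l t q : Fin d),
      - x (⟨(i, j), hij⟩, (l, t)) + x (⟨(j, k), hjk⟩, (t, q))
          + x (⟨(i, k), lt_trans hij hjk⟩, (l, q)) ≤ 1 ∧
      x (⟨(i, j), hij⟩, (l, t)) - x (⟨(j, k), hjk⟩, (t, q))
          + x (⟨(i, k), lt_trans hij hjk⟩, (l, q)) ≤ 1 ∧
      x (⟨(i, j), hij⟩, (l, t)) + x (⟨(j, k), hjk⟩, (t, q))
          - x (⟨(i, k), lt_trans hij hjk⟩, (l, q)) ≤ 1)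

/-- The joint matching polytope `C_{n,d}`: the convex hull of the vectorizations of all
consistent partial maps. -/
def jointMatchingPolytope (n d : ℕ) : Set (JIdx n d → ℝ) :=
  convexHull ℝ {x | IsConsistentVec n d x}

lemma card_pairIdx (n : ℕ) : Fintype.card (PairIdx n) = n.choose 2 := by
  have e : PairIdx n ≃ Σ j : Fin n, Fin j.val :=
    { toFun := fun p => ⟨p.1.2, ⟨p.1.1.val, p.2⟩⟩
      invFun := fun s => ⟨(⟨s.2.val, s.2.2.trans s.1.2⟩, s.1), s.2.2⟩
      left_inv := fun p => rfl
      right_inv := fun s => rfl }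
  rw [Fintype.card_congr e, Fintype.card_sigma]
  simp only [Fintype.card_fin]
  rw [Fin.sum_univ_eq_sum_range (fun i => i) n, Finset.sum_range_id, Nat.choose_two_right]

lemma isConsistentVec_zero (n d : ℕ) : IsConsistentVec n d 0 := by
  refine ⟨fun _ _ _ => Or.inl rfl, ?_, ?_, ?_⟩ <;> intros <;> simp

lemma isConsistentVec_single (n d : ℕ) (c : JIdx n d) :
    IsConsistentVec n d (Pi.single c 1) := by
  obtain ⟨e, a, b⟩ := c
  refine ⟨?_, ?_, ?_, ?_⟩
  · intro f t q
    by_cases h : ((f, (t, q)) : JIdx n d) = (e, a, b)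
    · right; simp [h]
    · left; simp [Pi.single_apply, h]
  · intro f t
    by_cases h : f = e ∧ t = a
    · obtain ⟨rfl, rfl⟩ := h
      simp [Pi.single_apply]
    · have : ∀ q, (Pi.single (e, a, b) 1 : JIdx n d → ℝ) (f, (t, q)) = 0 := by
        intro q
        rw [Pi.single_apply, if_neg]
        intro h'
        simp only [Prod.mk.injEq] at h'
        exact h ⟨h'.1, h'.2.1⟩
      simp [this]
  · intro f q
    by_cases h : f = e ∧ q = b
    · obtain ⟨rfl, rfl⟩ := h
      simp [Pi.single_apply]
    · have : ∀ t, (Pi.single (e, a, b) 1 : JIdx n d → ℝ) (f, (t, q)) = 0 := by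
        intro t
        rw [Pi.single_apply, if_neg]
        intro h'
        simp only [Prod.mk.injEq] at h'
        exact h ⟨h'.1, h'.2.2⟩
      simp [this]
  · intro i j k hij hjk l t q
    obtain ⟨⟨u, v⟩, huv⟩ := e
    have h1 : i ≠ j := hij.ne
    have h2 : j ≠ k := hjk.ne
    simp only [Pi.single_apply, Prod.mk.injEq, Subtype.mk.injEq]
    refine ⟨?_, ?_, ?_⟩ <;> split_ifs <;> first | (norm_num; done) | (exfalso; grind)

/-- Every nonnegativity inequality `X_{tq}(i,j) ≥ 0` is facet-defining for the joint
matching polytope: it is valid, and the corresponding face has affine dimension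
`(n choose 2) * d ^ 2 - 1`. -/
theorem nonnegativity_facet_defining (n d : ℕ) (hn : 3 ≤ n) (hd : 2 ≤ d)
    (e : PairIdx n) (t q : Fin d) :
    (∀ x ∈ jointMatchingPolytope n d, 0 ≤ x (e, (t, q))) ∧
    Module.finrank ℝ
        ↥(vectorSpan ℝ {x ∈ jointMatchingPolytope n d | x (e, (t, q)) = 0}) =
      n.choose 2 * d ^ 2 - 1 := by
  have hvalid : ∀ x ∈ jointMatchingPolytope n d, 0 ≤ x (e, (t, q)) := by
    intro x hx
    have hc : Convex ℝ {x : JIdx n d → ℝ | 0 ≤ x (e, (t, q))} :=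
      convex_halfSpace_ge (LinearMap.proj (R := ℝ) (φ := fun _ : JIdx n d => ℝ)
        (e, (t, q))).isLinear 0
    refine convexHull_min ?_ hc hx
    intro y hy
    rcases hy.1 e t q with h | h <;> simp [h]
  refine ⟨hvalid, ?_⟩
  set c : JIdx n d := (e, (t, q)) with hc
  set L : (JIdx n d → ℝ) →ₗ[ℝ] ℝ := LinearMap.proj c with hL
  have hspan : vectorSpan ℝ {x ∈ jointMatchingPolytope n d | x c = 0} = LinearMap.ker L := by
    apply le_antisymm
    · rw [vectorSpan_def, Submodule.span_le]
      rintro _ ⟨x, hx, y, hy, rfl⟩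
      have h1 := hx.2
      have h2 := hy.2
      simp [hL, h1, h2]
    · intro x hx
      have hxc : x c = 0 := hx
      rw [pi_eq_sum_univ' x]
      refine Submodule.sum_mem _ fun i _ => ?_
      by_cases hi : i = c
      · subst hi
        rw [hxc, zero_smul]
        exact Submodule.zero_mem _
      · refine Submodule.smul_mem _ _ ?_
        have hmem := vsub_mem_vectorSpan ℝ
          (s := {x ∈ jointMatchingPolytope n d | x c = 0})
          (p₁ := Pi.single i 1) (p₂ := 0)
          ⟨subset_convexHull ℝ _ (isConsistentVec_single n d i), by
            simp [Pi.single_apply, Ne.symm hi]⟩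
          ⟨subset_convexHull ℝ _ (isConsistentVec_zero n d), rfl⟩
        convert hmem using 1
        ext j
        simp [Pi.single_apply, eq_comm]
  rw [hspan]
  have hsurj : LinearMap.range L = ⊤ := by
    rw [LinearMap.range_eq_top]
    intro r
    exact ⟨fun _ => r, rfl⟩
  have hrn := LinearMap.finrank_range_add_finrank_ker L
  rw [hsurj, finrank_top, Module.finrank_self, Module.finrank_fintype_fun_eq_card,
    Fintype.card_prod, Fintype.card_prod, card_pairIdx, Fintype.card_fin, ← pow_two] at hrn
  omega
end

section
/- In the setting of the deterministic optimality conditions, suppose all inequalities in conditions (C1)–(C5) are strictly satisfied (i.e., with ≥ replaced by >). Then the ground truth X̄, with X̄(i,j) = I_d for all 1 ≤ i < j ≤ n, is the unique optimal solution of the basic LP (P). -/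
open Matrix
open scoped Classical

noncomputable section

/-- The permutation matrix of a permutation `σ` of `Fin d`. -/
def permMat (d : ℕ) (σ : Equiv.Perm (Fin d)) : Matrix (Fin d) (Fin d) ℝ :=
  Matrix.of fun t q => if σ q = t then 1 else 0

/-- The objective function of the basic LP (P):
`∑_{i<j} ∑_{t,q} a_{tq}(i,j) X_{tq}(i,j)`. -/
def lpObj (n d : ℕ) (a X : Fin n → Fin n → Matrix (Fin d) (Fin d) ℝ) : ℝ :=
  ∑ p ∈ Finset.univ.filter (fun p : Fin n × Fin n => p.1 < p.2),
    ∑ t : Fin d, ∑ q : Fin d, a p.1 p.2 t q * X p.1 p.2 t q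

/-- The feasible region of the basic LP (P): all row and column sums equal one,
the triangle inequalities hold, and all entries are nonnegative. -/
def lpFeasible (n d : ℕ) (X : Fin n → Fin n → Matrix (Fin d) (Fin d) ℝ) : Prop :=
  (∀ i j : Fin n, i < j → ∀ t : Fin d, ∑ q : Fin d, X i j t q = 1) ∧
  (∀ i j : Fin n, i < j → ∀ q : Fin d, ∑ t : Fin d, X i j t q = 1) ∧
  (∀ i j k : Fin n, i < j → j < k → ∀ l t q : Fin d,
      X i j l t + X j k t q - X i k l q ≤ 1 ∧
      X i j l t - X j k t q + X i k l q ≤ 1 ∧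
      - X i j l t + X j k t q + X i k l q ≤ 1) ∧
  (∀ i j : Fin n, i < j → ∀ t q : Fin d, 0 ≤ X i j t q)

/-- The quantity `δ_{t→q}^{i→j}` of the dual certificate. -/
def deltaJOM (n d : ℕ) (a : Fin n → Fin n → Matrix (Fin d) (Fin d) ℝ) (α β : ℝ)
    (i j : Fin n) (t q : Fin d) : ℝ :=
  (1 / (n : ℝ)) *
    ∑ k ∈ Finset.univ.filter (fun k : Fin n => k ≠ i ∧ k ≠ j ∧ a k i t t = -1),
      ((a k j t q - a i j t q) / α + (a i j t t - a k j t t) / (β * d))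

/-- The quantity `κ_t(i,j)` of the dual certificate. -/
def kappaJOM (n d : ℕ) (a : Fin n → Fin n → Matrix (Fin d) (Fin d) ℝ) (α β : ℝ)
    (i j : Fin n) (t : Fin d) : ℝ :=
  (1 / (n : ℝ)) *
      ∑ l ∈ Finset.univ.filter (fun l : Fin d => l ≠ t),
        ∑ k ∈ Finset.univ.filter (fun k : Fin n => k ≠ i ∧ k ≠ j),
          min (a k i l t / α + a k j t t / (β * d)) (a k j l t / α + a k i t t / (β * d))
    + (1 / (n : ℝ)) * (1 / (2 * α) - ((d : ℝ) - 1) / (2 * β * d)) *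
        ((∑ k ∈ Finset.univ.filter (fun k : Fin n => k ≠ i), a k i t t) +
          ∑ k ∈ Finset.univ.filter (fun k : Fin n => k ≠ j), a k j t t)
    - ((d : ℝ) - 2) / α + 1
    + (1 / (2 * (n : ℝ))) *
        ∑ l ∈ Finset.univ.filter (fun l : Fin d => l ≠ t),
          ((a i j t l + a j i t l) / α + 2 * a i j t t / (β * d))

/-- Antisymmetric flow bound for one fixed target. -/
lemma flow_bound {n : ℕ} (g : Fin n → Fin n → ℝ) (w : Fin n → ℝ) (v : Fin n → Fin n → ℝ)
    (hanti : ∀ k i, g k i = - g i k)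
    (hb : ∀ k i, g k i * (w i - w k) ≤ |g k i| * v k i) :
    2 * ∑ i, ∑ k, g k i * w i ≤ ∑ i, ∑ k, |g k i| * v k i := by
  have h1 : ∑ i, ∑ k, g k i * w k = - ∑ i, ∑ k, g k i * w i := by
    rw [Finset.sum_comm, ← Finset.sum_neg_distrib]
    refine Finset.sum_congr rfl fun i _ => ?_
    rw [← Finset.sum_neg_distrib]
    refine Finset.sum_congr rfl fun k _ => ?_
    rw [hanti i k]; ring
  have h2 : 2 * ∑ i, ∑ k, g k i * w i = ∑ i, ∑ k, g k i * (w i - w k) := by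
    simp only [mul_sub, Finset.sum_sub_distrib, h1]; ring
  rw [h2]
  exact Finset.sum_le_sum fun i _ => Finset.sum_le_sum fun k _ => hb k i

lemma core_bound (n d : ℕ) (a W : Fin n → Fin n → Matrix (Fin d) (Fin d) ℝ)
    (V ρ S : Fin d → Fin n → Fin n → ℝ)
    (G : Fin d → Fin d → Fin n → Fin n → Fin n → ℝ)
    (Wsym : ∀ i j t q, W j i q t = W i j t q)
    (Vsym : ∀ t i j, V t j i = V t i j)
    (Wrow : ∀ i j t, ∑ q, W i j t q = V t i j)
    (Ganti : ∀ t q k i j, G t q k i j = - G t q i k j)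
    (hS : ∀ t k i, S t k i = ∑ q, ∑ j, |G t q k i j|)
    (hG : ∀ t q k i j, G t q k i j * (W i j t q - W k j t q) ≤ |G t q k i j| * V t k i)
    (hρ : ∀ t i j, (S t i j + 2 * ρ t i j) * V t i j ≤ - a i j t t * V t i j) :
    ∑ i, ∑ j, ∑ t, ∑ q, (a i j t q + ∑ k, G t q k i j + ∑ k, G q t k j i + ρ t i j + ρ q i j)
        * W i j t q
      ≤ ∑ i, ∑ j, (∑ t, ∑ q, a i j t q * W i j t q - ∑ t, a i j t t * V t i j) := by
  have Wcol : ∀ i j q, ∑ t, W i j t q = V q i j := by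
    intro i j q
    rw [← Vsym, ← Wrow]
    exact Finset.sum_congr rfl fun t _ => (Wsym _ _ _ _).symm
  have P3 : ∑ i, ∑ j, ∑ t, ∑ q, (∑ k, G q t k j i) * W i j t q
      = ∑ i, ∑ j, ∑ t, ∑ q, (∑ k, G t q k i j) * W i j t q := by
    rw [Finset.sum_comm]
    refine Finset.sum_congr rfl fun i _ => Finset.sum_congr rfl fun j _ => ?_
    rw [Finset.sum_comm]
    refine Finset.sum_congr rfl fun t _ => Finset.sum_congr rfl fun q _ => ?_
    rw [Wsym]
  have P4 : ∑ i, ∑ j, ∑ t, ∑ q, ρ t i j * W i j t q = ∑ i, ∑ j, ∑ t, ρ t i j * V t i j := by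
    simp only [← Finset.mul_sum, Wrow]
  have P5 : ∑ i, ∑ j, ∑ t, ∑ q, ρ q i j * W i j t q = ∑ i, ∑ j, ∑ t, ρ t i j * V t i j := by
    refine Finset.sum_congr rfl fun i _ => Finset.sum_congr rfl fun j _ => ?_
    rw [Finset.sum_comm]
    simp only [← Finset.mul_sum, Wcol]
  have P2 : 2 * ∑ i, ∑ j, ∑ t, ∑ q, (∑ k, G t q k i j) * W i j t q
      ≤ ∑ i, ∑ j, ∑ t, S t i j * V t i j := by
    have e1 : ∑ i, ∑ j, ∑ t, ∑ q, (∑ k, G t q k i j) * W i j t q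
        = ∑ t, ∑ q, ∑ j, ∑ i, ∑ k, G t q k i j * W i j t q := by
      simp only [Finset.sum_mul]
      rw [Finset.sum_comm]
      calc _ = ∑ j, ∑ t, ∑ i, ∑ q, ∑ k, G t q k i j * W i j t q :=
            Finset.sum_congr rfl fun j _ => Finset.sum_comm
        _ = ∑ t, ∑ j, ∑ i, ∑ q, ∑ k, G t q k i j * W i j t q := Finset.sum_comm
        _ = ∑ t, ∑ j, ∑ q, ∑ i, ∑ k, G t q k i j * W i j t q :=
            Finset.sum_congr rfl fun t _ => Finset.sum_congr rfl fun j _ => Finset.sum_comm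
        _ = _ := Finset.sum_congr rfl fun t _ => Finset.sum_comm
    have e2 : ∑ i, ∑ j, ∑ t, S t i j * V t i j
        = ∑ t, ∑ q, ∑ j, ∑ i, ∑ k, |G t q k i j| * V t k i := by
      calc _ = ∑ i, ∑ k, ∑ t, S t k i * V t k i := Finset.sum_comm
        _ = ∑ i, ∑ t, ∑ k, S t k i * V t k i :=
            Finset.sum_congr rfl fun i _ => Finset.sum_comm
        _ = ∑ t, ∑ i, ∑ k, S t k i * V t k i := Finset.sum_comm
        _ = ∑ t, ∑ i, ∑ k, ∑ q, ∑ j, |G t q k i j| * V t k i := by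
            simp only [hS, Finset.sum_mul]
        _ = ∑ t, ∑ i, ∑ q, ∑ k, ∑ j, |G t q k i j| * V t k i :=
            Finset.sum_congr rfl fun t _ => Finset.sum_congr rfl fun i _ => Finset.sum_comm
        _ = ∑ t, ∑ q, ∑ i, ∑ k, ∑ j, |G t q k i j| * V t k i :=
            Finset.sum_congr rfl fun t _ => Finset.sum_comm
        _ = ∑ t, ∑ q, ∑ i, ∑ j, ∑ k, |G t q k i j| * V t k i :=
            Finset.sum_congr rfl fun t _ => Finset.sum_congr rfl fun q _ =>
              Finset.sum_congr rfl fun i _ => Finset.sum_comm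
        _ = _ := Finset.sum_congr rfl fun t _ => Finset.sum_congr rfl fun q _ => Finset.sum_comm
    rw [e1, e2]
    simp only [Finset.mul_sum (a := (2 : ℝ)) (s := (Finset.univ : Finset (Fin d)))]
    refine Finset.sum_le_sum fun t _ => Finset.sum_le_sum fun q _ => ?_
    rw [Finset.mul_sum]
    refine Finset.sum_le_sum fun j _ => ?_
    exact flow_bound (fun k i => G t q k i j) (fun i => W i j t q) (fun k i => V t k i)
      (fun k i => Ganti t q k i j) (fun k i => hG t q k i j)
  have P6 : ∑ i, ∑ j, ∑ t, S t i j * V t i j + 2 * ∑ i, ∑ j, ∑ t, ρ t i j * V t i j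
      ≤ - ∑ i, ∑ j, ∑ t, a i j t t * V t i j := by
    simp only [Finset.mul_sum, ← Finset.sum_neg_distrib, ← Finset.sum_add_distrib]
    refine Finset.sum_le_sum fun i _ => Finset.sum_le_sum fun j _ =>
      Finset.sum_le_sum fun t _ => ?_
    have := hρ t i j
    linarith
  simp only [add_mul, Finset.sum_add_distrib, Finset.sum_sub_distrib]
  rw [P3, P4, P5]
  linarith

/-- Basic facts about the cost matrices. -/
lemma a_facts (n d : ℕ) (Xin : Fin n → Fin n → Matrix (Fin d) (Fin d) ℝ)
    (hperm : ∀ i j : Fin n, i < j → ∃ σ : Equiv.Perm (Fin d), Xin i j = permMat d σ)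
    (htr : ∀ i j : Fin n, Xin j i = (Xin i j)ᵀ)
    (a : Fin n → Fin n → Matrix (Fin d) (Fin d) ℝ)
    (ha : ∀ (i j : Fin n) (t q : Fin d), a i j t q = 1 - 2 * Xin i j t q)
    (i j : Fin n) (hij : i ≠ j) :
    ∃ σ : Equiv.Perm (Fin d), ∀ t q, a i j t q = if σ q = t then -1 else 1 := by
  rcases lt_or_gt_of_ne hij with h | h
  · obtain ⟨σ, hσ⟩ := hperm i j h
    refine ⟨σ, fun t q => ?_⟩
    rw [ha, hσ]
    simp only [permMat, Matrix.of_apply]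
    split_ifs <;> norm_num
  · obtain ⟨σ, hσ⟩ := hperm j i h
    refine ⟨σ.symm, fun t q => ?_⟩
    rw [ha, htr j i, hσ]
    simp only [permMat, Matrix.of_apply, Matrix.transpose_apply]
    have : (σ t = q) ↔ (σ.symm q = t) := by
      rw [Equiv.symm_apply_eq]; exact eq_comm
    simp only [this]
    split_ifs <;> norm_num

lemma row_sum_signs (d : ℕ) (σ : Equiv.Perm (Fin d)) (t : Fin d) :
    ∑ l, (if σ l = t then (-1 : ℝ) else 1) = d - 2 := by
  have : ∀ l, (if σ l = t then (-1 : ℝ) else 1) = 1 - 2 * (if l = σ.symm t then 1 else 0) := by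
    intro l
    have : (σ l = t) ↔ (l = σ.symm t) := by rw [Equiv.eq_symm_apply]
    simp only [this]
    split_ifs <;> norm_num
  simp only [this, Finset.sum_sub_distrib, ← Finset.mul_sum]
  simp

lemma offdiag_sum (d : ℕ) (t : Fin d) (f : Fin d → ℝ) (c : ℝ) (h : ∑ l, f l = c) :
    ∑ l ∈ Finset.univ.filter (fun l : Fin d => l ≠ t), f l = c - f t := by
  have := Finset.sum_erase_eq_sub (f := f) (Finset.mem_univ t)
  rw [h] at this
  rw [← this]
  refine Finset.sum_congr ?_ fun _ _ => rfl
  ext; simp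

lemma min_eq_avg (x y : ℝ) : min x y = (x + y) / 2 - |x - y| / 2 := by
  rcases le_total x y with h | h
  · rw [min_eq_left h, abs_of_nonpos (by linarith)]; ring
  · rw [min_eq_right h, abs_of_nonneg (by linarith)]; ring

lemma kappa_le (n d : ℕ) (hn : 3 ≤ n) (hd : 2 ≤ d) (α β : ℝ) (hα : 0 < α) (hβ : 0 < β)
    (a : Fin n → Fin n → Matrix (Fin d) (Fin d) ℝ)
    (asym : ∀ i j t q, a j i q t = a i j t q)
    (arow : ∀ i j, i ≠ j → ∀ t, ∑ l, a i j t l = (d : ℝ) - 2)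
    (i j : Fin n) (hij : i ≠ j) (t : Fin d) :
    kappaJOM n d a α β i j t ≤ 1 - (1 / 2) *
      ∑ l ∈ Finset.univ.filter (fun l : Fin d => l ≠ t),
        ∑ k ∈ Finset.univ.filter (fun k : Fin n => k ≠ i ∧ k ≠ j),
          |(1 / (n : ℝ)) * ((a i k t l - a j k t l) / α
            + (a j k t t - a i k t t) / (β * d))| := by
  have hn0 : (0 : ℝ) < n := by exact_mod_cast (by omega : 0 < n)
  have hd0 : (0 : ℝ) < d := by exact_mod_cast (by omega : 0 < d)
  have hd2 : (2 : ℝ) ≤ d := by exact_mod_cast hd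
  have hcardL : (((Finset.univ.filter (fun l : Fin d => l ≠ t)).card : ℕ) : ℝ) = (d : ℝ) - 1 := by
    have := offdiag_sum d t (fun _ => (1 : ℝ)) d (by simp)
    simpa using this
  have hKi : ∀ f : Fin n → ℝ, ∑ k ∈ Finset.univ.filter (fun k : Fin n => k ≠ i), f k
      = f j + ∑ k ∈ Finset.univ.filter (fun k : Fin n => k ≠ i ∧ k ≠ j), f k := by
    intro f
    rw [← Finset.add_sum_erase (Finset.univ.filter (fun k : Fin n => k ≠ i)) f
      (a := j) (by simp [hij.symm])]
    congr 1
    refine Finset.sum_congr ?_ fun _ _ => rfl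
    ext x; simp [and_comm]
  have hKj : ∀ f : Fin n → ℝ, ∑ k ∈ Finset.univ.filter (fun k : Fin n => k ≠ j), f k
      = f i + ∑ k ∈ Finset.univ.filter (fun k : Fin n => k ≠ i ∧ k ≠ j), f k := by
    intro f
    rw [← Finset.add_sum_erase (Finset.univ.filter (fun k : Fin n => k ≠ j)) f
      (a := i) (by simp [hij])]
    congr 1
    refine Finset.sum_congr ?_ fun _ _ => rfl
    ext x; simp
  have hcardK : (((Finset.univ.filter (fun k : Fin n => k ≠ i ∧ k ≠ j)).card : ℕ) : ℝ)
      = (n : ℝ) - 2 := by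
    have h1 := hKi (fun _ => 1)
    have h2 := offdiag_sum n i (fun _ => (1 : ℝ)) n (by simp)
    rw [h2] at h1
    simp only [Finset.sum_const, nsmul_eq_mul, mul_one] at h1
    linarith
  unfold kappaJOM
  rw [hKi, hKj]
  set L := Finset.univ.filter (fun l : Fin d => l ≠ t) with hL
  set K := Finset.univ.filter (fun k : Fin n => k ≠ i ∧ k ≠ j) with hK
  have hL1 : ∀ i' j', i' ≠ j' → ∑ l ∈ L, a i' j' t l = (d : ℝ) - 2 - a i' j' t t :=
    fun i' j' h => offdiag_sum d t _ _ (arow i' j' h t)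
  have hmin : ∑ l ∈ L, ∑ k ∈ K,
        min (a k i l t / α + a k j t t / (β * d)) (a k j l t / α + a k i t t / (β * d))
      = (1 / 2) * (∑ k ∈ K, ((2 * ((d : ℝ) - 2) - a k i t t - a k j t t) / α
          + ((d : ℝ) - 1) * (a k j t t + a k i t t) / (β * d)))
        - (1 / 2) * ∑ l ∈ L, ∑ k ∈ K, |(a i k t l - a j k t l) / α
            + (a j k t t - a i k t t) / (β * d)| := by
    have e1 : ∀ k ∈ K, ((2 * ((d : ℝ) - 2) - a k i t t - a k j t t) / α
          + ((d : ℝ) - 1) * (a k j t t + a k i t t) / (β * d))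
        = ∑ l ∈ L, ((a i k t l + a j k t l) / α + (a k j t t + a k i t t) / (β * d)) := by
      intro k hk
      simp only [hK, Finset.mem_filter, Finset.mem_univ, true_and] at hk
      rw [Finset.sum_add_distrib, ← Finset.sum_div, Finset.sum_add_distrib,
        hL1 i k hk.1.symm, hL1 j k hk.2.symm, Finset.sum_const, nsmul_eq_mul, hcardL,
        asym k i t t, asym k j t t]
      ring
    rw [Finset.sum_congr rfl e1, Finset.sum_comm (s := K), Finset.mul_sum, Finset.mul_sum,
      ← Finset.sum_sub_distrib]
    refine Finset.sum_congr rfl fun l _ => ?_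
    rw [Finset.mul_sum, Finset.mul_sum, ← Finset.sum_sub_distrib]
    refine Finset.sum_congr rfl fun k _ => ?_
    rw [min_eq_avg, asym i k t l, asym j k t l, asym k i t t, asym k j t t]
    have : a i k t l / α + a k j t t / (β * d) - (a j k t l / α + a k i t t / (β * d))
      = (a i k t l - a j k t l) / α + (a k j t t - a k i t t) / (β * d) := by ring
    rw [this]
    ring
  have habs : ∑ l ∈ L, ∑ k ∈ K, |(1 / (n : ℝ)) * ((a i k t l - a j k t l) / α
            + (a j k t t - a i k t t) / (β * d))|
      = (1 / (n : ℝ)) * ∑ l ∈ L, ∑ k ∈ K, |(a i k t l - a j k t l) / α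
            + (a j k t t - a i k t t) / (β * d)| := by
    simp only [Finset.mul_sum, abs_mul, abs_of_pos (one_div_pos.mpr hn0)]
  have hlast : ∑ l ∈ L, ((a i j t l + a j i t l) / α + 2 * a i j t t / (β * d))
      = (2 * ((d : ℝ) - 2) - 2 * a i j t t) / α
        + ((d : ℝ) - 1) * (2 * a i j t t / (β * d)) := by
    rw [Finset.sum_add_distrib, ← Finset.sum_div, Finset.sum_add_distrib,
        hL1 i j hij, hL1 j i hij.symm, Finset.sum_const, nsmul_eq_mul, hcardL,
        asym i j t t]
    ring
  have hKsum : ∑ k ∈ K, ((2 * ((d : ℝ) - 2) - a k i t t - a k j t t) / α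
          + ((d : ℝ) - 1) * (a k j t t + a k i t t) / (β * d))
      = (2 * ((n : ℝ) - 2) * ((d : ℝ) - 2) - ∑ k ∈ K, a k i t t - ∑ k ∈ K, a k j t t) / α
        + ((d : ℝ) - 1) * (∑ k ∈ K, a k j t t + ∑ k ∈ K, a k i t t) / (β * d) := by
    rw [Finset.sum_add_distrib, ← Finset.sum_div, ← Finset.sum_div, ← Finset.mul_sum,
      Finset.sum_sub_distrib, Finset.sum_sub_distrib, Finset.sum_add_distrib, Finset.sum_const,
      nsmul_eq_mul, hcardK]
    ring
  rw [hmin, habs, hlast, hKsum, asym i j t t]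
  generalize ∑ l ∈ L, ∑ k ∈ K, |(a i k t l - a j k t l) / α
            + (a j k t t - a i k t t) / (β * d)| = M
  generalize ∑ k ∈ K, a k i t t = x
  generalize ∑ k ∈ K, a k j t t = y
  have key : 0 ≤ ((d : ℝ) - 2) / (n * α) := div_nonneg (by linarith) (by positivity)
  rw [← sub_nonneg]
  refine key.trans (le_of_eq ?_)
  field_simp
  ring

lemma sum_pairs {n : ℕ} (g : Fin n → Fin n → ℝ) (h0 : ∀ i, g i i = 0)
    (hs : ∀ i j, g j i = g i j) :
    ∑ i, ∑ j, g i j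
      = 2 * ∑ p ∈ Finset.univ.filter (fun p : Fin n × Fin n => p.1 < p.2), g p.1 p.2 := by
  rw [Finset.sum_filter, Fintype.sum_prod_type]
  have h1 : ∑ i, ∑ j, (if j < i then g i j else 0) = ∑ i, ∑ j, (if i < j then g i j else 0) := by
    rw [Finset.sum_comm]
    refine Finset.sum_congr rfl fun i _ => Finset.sum_congr rfl fun j _ => ?_
    rw [hs]
  have h2 : ∑ i, ∑ j, g i j
      = ∑ i, ∑ j, (if i < j then g i j else 0) + ∑ i, ∑ j, (if j < i then g i j else 0) := by
    simp only [← Finset.sum_add_distrib]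
    refine Finset.sum_congr rfl fun i _ => Finset.sum_congr rfl fun j _ => ?_
    rcases lt_trichotomy i j with h | h | h
    · simp [h, h.not_gt]
    · subst h; simp [h0]
    · simp [h, h.not_gt]
  rw [h2, h1]
  simp only []
  ring

lemma one_feasible (n d : ℕ) : lpFeasible n d (fun _ _ => 1) := by
  refine ⟨?_, ?_, ?_, ?_⟩
  · intro i j _ t
    simp [Matrix.one_apply]
  · intro i j _ t
    simp [Matrix.one_apply]
  · intro i j k _ _ l t q
    simp only [Matrix.one_apply]
    by_cases h1 : l = t <;> by_cases h2 : t = q <;> by_cases h3 : l = q <;>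
      simp_all
  · intro i j _ t q
    simp only [Matrix.one_apply]
    split_ifs <;> norm_num

/-- Symmetric extension of a feasible point. -/
def symExt {n d : ℕ} (Y : Fin n → Fin n → Matrix (Fin d) (Fin d) ℝ) (i j : Fin n)
    (t q : Fin d) : ℝ :=
  if i < j then Y i j t q else if j < i then Y j i q t else 0

lemma symExt_symm {n d : ℕ} (Y : Fin n → Fin n → Matrix (Fin d) (Fin d) ℝ) (i j : Fin n)
    (t q : Fin d) : symExt Y j i q t = symExt Y i j t q := by
  unfold symExt
  rcases lt_trichotomy i j with h | h | h
  · simp [h, h.not_gt]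
  · subst h; simp
  · simp [h, h.not_gt]

lemma symExt_row {n d : ℕ} (Y : Fin n → Fin n → Matrix (Fin d) (Fin d) ℝ)
    (hY : lpFeasible n d Y) (i j : Fin n) (hij : i ≠ j) (t : Fin d) :
    ∑ q, symExt Y i j t q = 1 := by
  unfold symExt
  rcases lt_or_gt_of_ne hij with h | h
  · simp only [h, if_true]; exact hY.1 i j h t
  · simp only [h, h.not_gt, if_true, if_false]; exact hY.2.1 j i h t

lemma symExt_nonneg {n d : ℕ} (Y : Fin n → Fin n → Matrix (Fin d) (Fin d) ℝ)
    (hY : lpFeasible n d Y) (i j : Fin n) (t q : Fin d) :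
    0 ≤ symExt Y i j t q := by
  unfold symExt
  split_ifs with h h'
  · exact hY.2.2.2 i j h t q
  · exact hY.2.2.2 j i h' q t
  · exact le_rfl

lemma symExt_tri {n d : ℕ} (Y : Fin n → Fin n → Matrix (Fin d) (Fin d) ℝ)
    (hY : lpFeasible n d Y) (i j k : Fin n) (hij : i ≠ j) (hjk : j ≠ k) (hik : i ≠ k)
    (l t q : Fin d) :
    symExt Y i j l t + symExt Y j k t q - symExt Y i k l q ≤ 1 := by
  have T := hY.2.2.1
  unfold symExt
  rcases lt_or_gt_of_ne hij with h1 | h1 <;> rcases lt_or_gt_of_ne hjk with h2 | h2 <;>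
    rcases lt_or_gt_of_ne hik with h3 | h3 <;>
    simp only [h1, h2, h3, h1.not_gt, h2.not_gt, h3.not_gt, if_true, if_false]
  · linarith [(T i j k h1 h2 l t q).1]
  · exact absurd (h1.trans h2) h3.not_gt
  · linarith [(T i k j h3 h2 l q t).2.1, (T i k j h3 h2 l q t).1, (T i k j h3 h2 l q t).2.2]
  · linarith [(T k i j h3 h1 q l t).2.1, (T k i j h3 h1 q l t).1, (T k i j h3 h1 q l t).2.2]
  · linarith [(T j i k h1 h3 t l q).2.1, (T j i k h1 h3 t l q).1, (T j i k h1 h3 t l q).2.2]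
  · linarith [(T j k i h2 h3 t q l).2.1, (T j k i h2 h3 t q l).1, (T j k i h2 h3 t q l).2.2]
  · exact absurd (h2.trans h1) h3.not_gt
  · linarith [(T k j i h2 h1 q t l).2.1, (T k j i h2 h1 q t l).1, (T k j i h2 h1 q t l).2.2]

/-- If conditions (C1)–(C5) hold strictly, then the ground truth (all identity matrices)
is the unique optimal solution of the basic LP (P): it is feasible, and every feasible
point that does not agree with it on all pairs `i < j` has strictly larger objective. -/
theorem ground_truth_unique_optimal_of_strict_C1_to_C5
    (n d : ℕ) (hn : 3 ≤ n) (hd : 2 ≤ d)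
    (α β : ℝ) (hα : 0 < α) (hβ : 0 < β)
    (Xin : Fin n → Fin n → Matrix (Fin d) (Fin d) ℝ)
    (hperm : ∀ i j : Fin n, i < j → ∃ σ : Equiv.Perm (Fin d), Xin i j = permMat d σ)
    (htr : ∀ i j : Fin n, Xin j i = (Xin i j)ᵀ)
    (a : Fin n → Fin n → Matrix (Fin d) (Fin d) ℝ)
    (ha : ∀ (i j : Fin n) (t q : Fin d), a i j t q = 1 - 2 * Xin i j t q)
    (hC1 : ∀ i j : Fin n, i < j → ∀ t q : Fin d,
        a i j t t = 1 → a i j q q = 1 → a i j t q = 1 →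
        0 < deltaJOM n d a α β i j t q ∧ 0 < deltaJOM n d a α β j i q t)
    (hC2 : ∀ i j : Fin n, i < j → ∀ t q : Fin d,
        a i j t t = 1 → a i j q q = 1 → a i j t q = -1 →
        1 < deltaJOM n d a α β i j t q ∧ 1 < deltaJOM n d a α β j i q t)
    (hC3 : ∀ i j : Fin n, i < j → ∀ t q : Fin d,
        a i j t t = -1 → a i j q q = -1 → a i j t q = 1 →
        0 < kappaJOM n d a α β i j t +
            (deltaJOM n d a α β i j t q + deltaJOM n d a α β j i q t) / 2 ∧
        0 < kappaJOM n d a α β i j q +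
            (deltaJOM n d a α β i j t q + deltaJOM n d a α β j i q t) / 2)
    (hC4 : ∀ i j : Fin n, i < j → ∀ t q : Fin d,
        a i j t t = 1 → a i j q q = -1 → a i j t q = 1 →
        0 < kappaJOM n d a α β i j q +
            deltaJOM n d a α β i j t q + deltaJOM n d a α β j i q t)
    (hC5 : ∀ i j : Fin n, i < j → ∀ t q : Fin d,
        a i j t t = -1 → a i j q q = 1 → a i j t q = 1 →
        0 < kappaJOM n d a α β i j t +
            deltaJOM n d a α β i j t q + deltaJOM n d a α β j i q t) :
    lpFeasible n d (fun _ _ => 1) ∧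
      ∀ Y : Fin n → Fin n → Matrix (Fin d) (Fin d) ℝ,
        lpFeasible n d Y →
          (∀ i j : Fin n, i < j → Y i j = 1) ∨
            lpObj n d a (fun _ _ => 1) < lpObj n d a Y := by
  refine ⟨one_feasible n d, fun Y hY => ?_⟩
  have asym : ∀ i j t q, a j i q t = a i j t q := by
    intro i j t q
    rw [ha, ha, htr i j, Matrix.transpose_apply]
  have hσ := a_facts n d Xin hperm htr a ha
  have arow : ∀ i j, i ≠ j → ∀ t, ∑ l, a i j t l = (d : ℝ) - 2 := by
    intro i j hij t
    obtain ⟨σ, h⟩ := hσ i j hij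
    simp only [h]
    exact row_sum_signs d σ t
  have asign : ∀ i j, i ≠ j → ∀ t q, a i j t q = 1 ∨ a i j t q = -1 := by
    intro i j hij t q
    obtain ⟨σ, h⟩ := hσ i j hij
    rw [h]
    split_ifs <;> simp
  have aexR : ∀ i j, i ≠ j → ∀ t q, t ≠ q → a i j t t = -1 → a i j t q = 1 := by
    intro i j hij t q htq
    obtain ⟨σ, h⟩ := hσ i j hij
    rw [h, h]
    split_ifs with h1 h2
    · exact fun _ => absurd (σ.injective (h1.trans h2.symm)) htq
    · simp
    · norm_num
    · norm_num
  have aexC : ∀ i j, i ≠ j → ∀ t q, t ≠ q → a i j q q = -1 → a i j t q = 1 := by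
    intro i j hij t q htq hq
    rw [← asym]
    exact aexR j i hij.symm q t htq.symm (by rw [asym]; exact hq)
  set F : Fin d → Fin d → Fin n → Fin n → Fin n → ℝ := fun t q k i j =>
    (1 / (n : ℝ)) * ((a k j t q - a i j t q) / α + (a i j t t - a k j t t) / (β * d)) with hF
  set G : Fin d → Fin d → Fin n → Fin n → Fin n → ℝ := fun t q k i j =>
    if k ≠ i ∧ k ≠ j ∧ i ≠ j ∧ t ≠ q ∧ a k i t t = -1 then F t q k i j else 0 with hGdef
  set W : Fin n → Fin n → Matrix (Fin d) (Fin d) ℝ := fun i j => Matrix.of fun t q =>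
    if i ≠ j ∧ t ≠ q then symExt Y i j t q else 0 with hW
  set V : Fin d → Fin n → Fin n → ℝ := fun t i j =>
    if i ≠ j then 1 - symExt Y i j t t else 0 with hV
  set S : Fin d → Fin n → Fin n → ℝ := fun t k i => ∑ q, ∑ j, |G t q k i j| with hS
  set ρ : Fin d → Fin n → Fin n → ℝ := fun t i j =>
    if a i j t t = 1 then -1 / 2 else 1 / 2 - S t i j / 2 with hρ
  have Ganti : ∀ t q k i j, G t q k i j = - G t q i k j := by
    intro t q k i j
    simp only [hGdef, hF]
    by_cases h : k ≠ i ∧ k ≠ j ∧ i ≠ j ∧ t ≠ q ∧ a k i t t = -1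
    · have h' : i ≠ k ∧ i ≠ j ∧ k ≠ j ∧ t ≠ q ∧ a i k t t = -1 :=
        ⟨h.1.symm, h.2.2.1, h.2.1, h.2.2.2.1, by rw [asym]; exact h.2.2.2.2⟩
      rw [if_pos h, if_pos h']; ring
    · have h' : ¬ (i ≠ k ∧ i ≠ j ∧ k ≠ j ∧ t ≠ q ∧ a i k t t = -1) := fun h' =>
        h ⟨h'.1.symm, h'.2.2.1, h'.2.1, h'.2.2.2.1, by rw [asym]; exact h'.2.2.2.2⟩
      rw [if_neg h, if_neg h']; simp
  have Ssym : ∀ t i j, S t j i = S t i j := by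
    intro t i j
    simp only [hS]
    refine Finset.sum_congr rfl fun q _ => Finset.sum_congr rfl fun k _ => ?_
    rw [Ganti, abs_neg]
  have ρsym : ∀ t i j, ρ t j i = ρ t i j := by
    intro t i j
    simp only [hρ, Ssym t i j, asym i j t t]
  have Wsym : ∀ i j t q, W j i q t = W i j t q := by
    intro i j t q
    simp only [hW, Matrix.of_apply, symExt_symm Y i j t q, ne_comm]
  have Vsym : ∀ t i j, V t j i = V t i j := by
    intro t i j
    simp only [hV, symExt_symm Y i j t t, ne_comm]
  have Wrow : ∀ i j t, ∑ q, W i j t q = V t i j := by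
    intro i j t
    by_cases hij : i = j
    · simp [hW, hV, hij]
    · have := offdiag_sum d t (fun q => symExt Y i j t q) 1 (symExt_row Y hY i j hij t)
      simp only [hW, hV, Matrix.of_apply, ne_eq, hij, not_false_eq_true, true_and, if_true]
      rw [← this, Finset.sum_filter]
      refine Finset.sum_congr rfl fun q _ => ?_
      simp only [ne_eq, eq_comm]
  have Wnn : ∀ i j t q, 0 ≤ W i j t q := by
    intro i j t q
    simp only [hW, Matrix.of_apply]
    split_ifs
    · exact symExt_nonneg Y hY i j t q
    · exact le_rfl
  have hG : ∀ t q k i j, G t q k i j * (W i j t q - W k j t q) ≤ |G t q k i j| * V t k i := by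
    intro t q k i j
    by_cases h : k ≠ i ∧ k ≠ j ∧ i ≠ j ∧ t ≠ q ∧ a k i t t = -1
    · obtain ⟨h1, h2, h3, h4, -⟩ := h
      have e1 : W i j t q = symExt Y i j t q := by simp [hW, h3, h4]
      have e2 : W k j t q = symExt Y k j t q := by simp [hW, h2, h4]
      have e3 : V t k i = 1 - symExt Y k i t t := by simp [hV, h1]
      have t1 := symExt_tri Y hY k i j h1 h3 h2 t t q
      have t2 := symExt_tri Y hY i k j h1.symm h2 h3 t t q
      rw [symExt_symm Y k i t t] at t2
      have hb : |W i j t q - W k j t q| ≤ V t k i := by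
        rw [e1, e2, e3, abs_le]; constructor <;> linarith
      calc _ ≤ |G t q k i j * (W i j t q - W k j t q)| := le_abs_self _
        _ = |G t q k i j| * |W i j t q - W k j t q| := abs_mul _ _
        _ ≤ _ := mul_le_mul_of_nonneg_left hb (abs_nonneg _)
    · have : G t q k i j = 0 := by simp only [hGdef]; rw [if_neg h]
      rw [this]; simp
  have hρS : ∀ t i j, (S t i j + 2 * ρ t i j) * V t i j ≤ - a i j t t * V t i j := by
    intro t i j
    by_cases hij : i = j
    · simp [hV, hij]
    · rcases asign i j hij t t with h | h
      · have hS0 : S t i j = 0 := by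
          simp only [hS]
          refine Finset.sum_eq_zero fun q _ => Finset.sum_eq_zero fun k _ => ?_
          simp only [hGdef]
          rw [if_neg, abs_zero]
          rintro ⟨-, -, -, -, h'⟩
          rw [h] at h'; norm_num at h'
        have : ρ t i j = -1 / 2 := by simp only [hρ]; rw [if_pos h]
        rw [hS0, this, h]; norm_num
      · have : ρ t i j = 1 / 2 - S t i j / 2 := by
          simp only [hρ]; rw [if_neg]; rw [h]; norm_num
        rw [this, h]
        apply le_of_eq; ring
  have hcore := core_bound n d a W V ρ S G Wsym Vsym Wrow Ganti (fun _ _ _ => rfl) hG hρS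
  have hδ : ∀ i j t q, i ≠ j → t ≠ q → deltaJOM n d a α β i j t q = ∑ k, G t q k i j := by
    intro i j t q hij htq
    unfold deltaJOM
    rw [Finset.mul_sum, Finset.sum_filter]
    refine Finset.sum_congr rfl fun k _ => ?_
    simp only [hGdef, hF]
    by_cases h : k ≠ i ∧ k ≠ j ∧ a k i t t = -1
    · rw [if_pos h, if_pos ⟨h.1, h.2.1, hij, htq, h.2.2⟩]
    · rw [if_neg h, if_neg]
      exact fun h' => h ⟨h'.1, h'.2.1, h'.2.2.2.2⟩
  have hκ : ∀ i j t, i ≠ j → a i j t t = -1 →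
      kappaJOM n d a α β i j t ≤ 1 - (1 / 2) * S t i j := by
    intro i j t hij h
    refine (kappa_le n d hn hd α β hα hβ a asym arow i j hij t).trans (le_of_eq ?_)
    congr 2
    simp only [hS]
    rw [Finset.sum_filter]
    refine Finset.sum_congr rfl fun l _ => ?_
    by_cases hl : l = t
    · simp [hl, hGdef]
    · rw [if_pos hl, Finset.sum_filter]
      refine Finset.sum_congr rfl fun k _ => ?_
      simp only [hGdef, hF]
      by_cases hk : k ≠ i ∧ k ≠ j
      · rw [if_pos hk, if_pos ⟨hij, hk.1.symm, hk.2.symm, fun h => hl h.symm, h⟩]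
      · rw [if_neg hk, if_neg, abs_zero]
        exact fun h' => hk ⟨h'.2.1.symm, h'.2.2.1.symm⟩
  have μpos' : ∀ i j t q, i < j → t ≠ q →
      0 < a i j t q + ∑ k, G t q k i j + ∑ k, G q t k j i + ρ t i j + ρ q i j := by
    intro i j t q hlt htq
    have hij := hlt.ne
    rw [← hδ i j t q hij htq, ← hδ j i q t hij.symm htq.symm]
    have r1 : ∀ t, a i j t t = 1 → ρ t i j = -1 / 2 := by
      intro t h; simp only [hρ]; rw [if_pos h]
    have r2 : ∀ t, a i j t t = -1 → kappaJOM n d a α β i j t - 1 / 2 ≤ ρ t i j := by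
      intro t h
      have : ρ t i j = 1 / 2 - S t i j / 2 := by
        simp only [hρ]; rw [if_neg]; rw [h]; norm_num
      rw [this]
      linarith [hκ i j t hij h]
    rcases asign i j hij t t with ht | ht <;> rcases asign i j hij q q with hq | hq
    · rcases asign i j hij t q with h | h
      · have := hC1 i j hlt t q ht hq h
        rw [r1 t ht, r1 q hq, h]; linarith [this.1, this.2]
      · have := hC2 i j hlt t q ht hq h
        rw [r1 t ht, r1 q hq, h]; linarith [this.1, this.2]
    · have h := aexC i j hij t q htq hq
      have := hC4 i j hlt t q ht hq h
      rw [r1 t ht, h]; linarith [r2 q hq]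
    · have h := aexR i j hij t q htq ht
      have := hC5 i j hlt t q ht hq h
      rw [r1 q hq, h]; linarith [r2 t ht]
    · have h := aexR i j hij t q htq ht
      have := hC3 i j hlt t q ht hq h
      rw [h]; linarith [r2 t ht, r2 q hq, this.1, this.2]
  have μpos : ∀ i j t q, i ≠ j → t ≠ q →
      0 < a i j t q + ∑ k, G t q k i j + ∑ k, G q t k j i + ρ t i j + ρ q i j := by
    intro i j t q hij htq
    rcases lt_or_gt_of_ne hij with h | h
    · exact μpos' i j t q h htq
    · have := μpos' j i q t h htq.symm
      rw [asym i j t q, ρsym t i j, ρsym q i j] at this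
      linarith
  have μW : ∀ i j t q, 0 ≤ (a i j t q + ∑ k, G t q k i j + ∑ k, G q t k j i + ρ t i j + ρ q i j)
        * W i j t q := by
    intro i j t q
    by_cases h : i ≠ j ∧ t ≠ q
    · exact mul_nonneg (μpos i j t q h.1 h.2).le (Wnn i j t q)
    · have : W i j t q = 0 := by simp only [hW, Matrix.of_apply]; rw [if_neg h]
      rw [this, mul_zero]
  have hobj : ∑ i, ∑ j, (∑ t, ∑ q, a i j t q * W i j t q - ∑ t, a i j t t * V t i j)
      = 2 * (lpObj n d a Y - lpObj n d a (fun _ _ => 1)) := by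
    rw [sum_pairs (fun i j => ∑ t, ∑ q, a i j t q * W i j t q - ∑ t, a i j t t * V t i j)]
    · unfold lpObj
      rw [← Finset.sum_sub_distrib]
      congr 1
      refine Finset.sum_congr rfl fun p hp => ?_
      have hp : p.1 < p.2 := by simpa using hp
      rw [← Finset.sum_sub_distrib, ← Finset.sum_sub_distrib]
      refine Finset.sum_congr rfl fun t _ => ?_
      rw [← Finset.sum_sub_distrib]
      have : a p.1 p.2 t t * V t p.1 p.2
          = ∑ q, if q = t then a p.1 p.2 t q * V t p.1 p.2 else 0 := by simp
      rw [this, ← Finset.sum_sub_distrib]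
      refine Finset.sum_congr rfl fun q _ => ?_
      by_cases hq : q = t
      · subst hq
        simp [hW, hV, hp.ne, symExt, hp]
        ring
      · have hq' : ¬ t = q := fun h => hq h.symm
        simp [hW, hq, hq', hp.ne, symExt, hp, Matrix.one_apply]
    · intro i
      simp [hW, hV]
    · intro i j
      congr 1
      · rw [Finset.sum_comm]
        refine Finset.sum_congr rfl fun t _ => Finset.sum_congr rfl fun q _ => ?_
        rw [asym i j, Wsym i j]
      · refine Finset.sum_congr rfl fun t _ => ?_
        rw [asym i j, Vsym t i j]
  rw [hobj] at hcore
  by_cases hall : ∀ i j t q, W i j t q = 0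
  · left
    intro i j hlt
    ext t q
    by_cases htq : t = q
    · subst htq
      have := Wrow i j t
      simp only [hall, Finset.sum_const_zero, hV, ne_eq, hlt.ne, not_false_eq_true, if_true,
        symExt, hlt] at this
      rw [Matrix.one_apply_eq]; linarith
    · have := hall i j t q
      simp only [hW, Matrix.of_apply, ne_eq, hlt.ne, htq, not_false_eq_true, and_self, if_true,
        symExt, hlt] at this
      rw [Matrix.one_apply_ne htq, this]
  · right
    push Not at hall
    obtain ⟨i, j, t, q, hne⟩ := hall
    have h : i ≠ j ∧ t ≠ q := by
      by_contra h
      apply hne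
      simp only [hW, Matrix.of_apply]; rw [if_neg h]
    have hpos : 0 < (a i j t q + ∑ k, G t q k i j + ∑ k, G q t k j i + ρ t i j + ρ q i j)
        * W i j t q :=
      mul_pos (μpos i j t q h.1 h.2) (lt_of_le_of_ne (Wnn i j t q) hne.symm)
    have hsum : 0 < ∑ i, ∑ j, ∑ t, ∑ q,
        (a i j t q + ∑ k, G t q k i j + ∑ k, G q t k j i + ρ t i j + ρ q i j) * W i j t q := by
      refine Finset.sum_pos' (fun i _ => Finset.sum_nonneg fun j _ => Finset.sum_nonneg fun t _ =>
        Finset.sum_nonneg fun q _ => μW i j t q) ⟨i, Finset.mem_univ _, ?_⟩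
      refine Finset.sum_pos' (fun j _ => Finset.sum_nonneg fun t _ =>
        Finset.sum_nonneg fun q _ => μW i j t q) ⟨j, Finset.mem_univ _, ?_⟩
      refine Finset.sum_pos' (fun t _ =>
        Finset.sum_nonneg fun q _ => μW i j t q) ⟨t, Finset.mem_univ _, ?_⟩
      exact Finset.sum_pos' (fun q _ => μW i j t q) ⟨q, Finset.mem_univ _, hpos⟩
    linarith

end
end
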